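/- Let d ≥ 2 be an integer and let i ∈ {1, …, d}. Then the point (1/(s_{d+1} − 2)) · ((s_{d+1} − 1)(e_1 + ⋯ + e_d) − s_i e_i) lies in the interior of the simplex T_d. -/

import Mathlib

open MeasureTheory ENNReal

noncomputable section

/-- Auxiliary recursion for the Sylvester sequence: `s_{i+1} = s_i (s_i - 1) + 1`,
which is equivalent to `s_i = 1 + s_1 ⋯ s_{i-1}` with `s_1 = 2`. -/
def sylAux : ℕ → ℕ
  | 0 => 2
  | n + 1 => sylAux n * (sylAux n - 1) + 1

/-- The Sylvester sequence `s_1 = 2`, `s_i = 1 + s_1 s_2 ⋯ s_{i-1}` (1-indexed). -/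
def syl (n : ℕ) : ℕ := sylAux (n - 1)

/-- The standard basis vector `e_i` of `ℝ^d`. -/
def stdBasis (d : ℕ) (i : Fin d) : Fin d → ℝ := Pi.single i 1

/-- The integer lattice `ℤ^d`, viewed as a subset of `ℝ^d`. -/
def latticePts (d : ℕ) : Set (Fin d → ℝ) :=
  Set.range fun z : Fin d → ℤ => fun i => (z i : ℝ)

/-- The simplex `T_d = conv(0, s_1 e_1, …, s_d e_d)`. -/
def Td (d : ℕ) : Set (Fin d → ℝ) :=
  convexHull ℝ (insert 0 (Set.range fun i : Fin d => (syl (i.1 + 1) : ℝ) • stdBasis d i))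

theorem sylAux_two_le (n : ℕ) : 2 ≤ sylAux n := by
  induction n with
  | zero => simp [sylAux]
  | succ n ih =>
    simp only [sylAux]
    have : 1 ≤ sylAux n - 1 := by omega
    nlinarith

theorem sylAux_succ_real (n : ℕ) :
    (sylAux (n + 1) : ℝ) = sylAux n * ((sylAux n : ℝ) - 1) + 1 := by
  have h := sylAux_two_le n
  simp only [sylAux]
  push_cast [Nat.cast_sub (show 1 ≤ sylAux n by omega)]
  ring

theorem sylAux_mono : StrictMono sylAux := by
  apply strictMono_nat_of_lt_succ
  intro n
  have h := sylAux_two_le n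
  simp only [sylAux]
  have : 1 ≤ sylAux n - 1 := by omega
  nlinarith

theorem sum_inv_sylAux (d : ℕ) :
    ∑ j : Fin d, (1 / (sylAux j.1 : ℝ)) = 1 - 1 / ((sylAux d : ℝ) - 1) := by
  induction d with
  | zero => norm_num [sylAux]
  | succ n ih =>
    rw [Fin.sum_univ_castSucc]
    simp only [Fin.val_castSucc, Fin.val_last]
    rw [ih, sylAux_succ_real]
    have h : (2 : ℝ) ≤ sylAux n := by exact_mod_cast sylAux_two_le n
    have h1 : (sylAux n : ℝ) ≠ 0 := by linarith
    have h2 : (sylAux n : ℝ) - 1 ≠ 0 := by linarith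
    rw [add_sub_cancel_right]
    field_simp
    ring

theorem subset_Td (d : ℕ) (x : Fin d → ℝ) (h0 : ∀ j, 0 < x j)
    (h1 : ∑ j, x j / (sylAux j.1 : ℝ) < 1) : x ∈ Td d := by
  have hc : Convex ℝ (Td d) := convex_convexHull ℝ _
  have hz : (0 : Fin d → ℝ) ∈ Td d := subset_convexHull ℝ _ (Set.mem_insert _ _)
  have hv : ∀ j : Fin d, (sylAux j.1 : ℝ) • stdBasis d j ∈ Td d := fun j =>
    subset_convexHull ℝ _ (Set.mem_insert_of_mem _ ⟨j, rfl⟩)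
  have key := hc.sum_mem (t := (Finset.univ : Finset (Option (Fin d))))
    (w := fun o => o.elim (1 - ∑ j, x j / (sylAux j.1 : ℝ)) (fun j => x j / (sylAux j.1 : ℝ)))
    (z := fun o => o.elim 0 (fun j => (sylAux j.1 : ℝ) • stdBasis d j))
    (by
      rintro (_ | j) _
      · simp only [Option.elim]; linarith
      · exact div_nonneg (h0 j).le (Nat.cast_nonneg _))
    (by simp [Fintype.sum_option])
    (by
      rintro (_ | j) _
      · exact hz
      · exact hv j)
  convert key using 1
  rw [Fintype.sum_option]
  ext k
  have hk : (sylAux k.1 : ℝ) ≠ 0 := by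
    have := sylAux_two_le k.1
    positivity
  simp [stdBasis, Finset.sum_apply, Pi.single_apply, hk]

/-- For `d ≥ 2` and `i ∈ {1, …, d}`, the point
`(1/(s_{d+1} - 2)) · ((s_{d+1} - 1)(e_1 + ⋯ + e_d) - s_i e_i)` lies in the interior of the
simplex `T_d`. -/
theorem special_point_mem_interior_Td (d : ℕ) (hd : 2 ≤ d) (i : Fin d) :
    (1 / ((syl (d + 1) : ℝ) - 2)) •
        (((syl (d + 1) : ℝ) - 1) • (fun _ => (1 : ℝ)) -
          (syl (i.1 + 1) : ℝ) • stdBasis d i) ∈ interior (Td d) := by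
  have hS : syl (d + 1) = sylAux d := rfl
  have hI : syl (i.1 + 1) = sylAux i.1 := rfl
  rw [hS, hI]
  have hopen : IsOpen {x : Fin d → ℝ | (∀ j, 0 < x j) ∧ ∑ j, x j / (sylAux j.1 : ℝ) < 1} := by
    have A : IsOpen {x : Fin d → ℝ | ∀ j, 0 < x j} := by
      have : {x : Fin d → ℝ | ∀ j, 0 < x j} = ⋂ j, {x : Fin d → ℝ | 0 < x j} := by
        ext x; simp
      rw [this]
      exact isOpen_iInter_of_finite fun j => isOpen_lt continuous_const (continuous_apply j)
    have B : IsOpen {x : Fin d → ℝ | ∑ j, x j / (sylAux j.1 : ℝ) < 1} :=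
      isOpen_lt (continuous_finsetSum _ fun j _ => (continuous_apply j).div_const _)
        continuous_const
    exact A.inter B
  refine interior_maximal (fun x hx => subset_Td d x hx.1 hx.2) hopen ?_
  have hs2 : (2 : ℝ) ≤ sylAux i.1 := by exact_mod_cast sylAux_two_le i.1
  have hP : (sylAux i.1 : ℝ) < (sylAux d : ℝ) - 1 := by
    obtain ⟨n, rfl⟩ : ∃ n, d = n + 2 := ⟨d - 2, by omega⟩
    have h3 : (sylAux i.1 : ℝ) ≤ sylAux (n + 1) := by
      exact_mod_cast sylAux_mono.monotone (by omega)
    have h4 : (3 : ℝ) ≤ sylAux (n + 1) := by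
      have := sylAux_two_le n
      have := sylAux_mono (Nat.lt_succ_self n)
      exact_mod_cast (show 3 ≤ sylAux (n + 1) by simp only [Nat.succ_eq_add_one] at this; omega)
    rw [sylAux_succ_real (n + 1)]
    nlinarith
  have hQ : (0 : ℝ) < (sylAux d : ℝ) - 2 := by linarith
  refine ⟨fun j => ?_, ?_⟩
  · simp only [Pi.smul_apply, Pi.sub_apply, smul_eq_mul, stdBasis, Pi.single_apply]
    apply _root_.mul_pos (by positivity)
    split_ifs <;> linarith
  · have e : ∀ j : Fin d, ((1 / ((sylAux d : ℝ) - 2)) •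
        (((sylAux d : ℝ) - 1) • (fun _ => (1 : ℝ)) -
          (sylAux i.1 : ℝ) • stdBasis d i) : Fin d → ℝ) j / (sylAux j.1 : ℝ) =
        (1 / ((sylAux d : ℝ) - 2)) * (((sylAux d : ℝ) - 1) * (1 / (sylAux j.1 : ℝ)) -
          if j = i then 1 else 0) := by
      intro j
      have hj : (sylAux j.1 : ℝ) ≠ 0 := by
        have := sylAux_two_le j.1
        positivity
      simp only [Pi.smul_apply, Pi.sub_apply, smul_eq_mul, stdBasis, Pi.single_apply]
      split_ifs with h
      · subst h
        field_simp
      · field_simp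
        ring
    rw [Finset.sum_congr rfl fun j _ => e j, ← Finset.mul_sum, Finset.sum_sub_distrib,
      ← Finset.mul_sum, sum_inv_sylAux]
    simp only [Finset.sum_ite_eq', Finset.mem_univ, if_true]
    have h5 : (sylAux d : ℝ) - 1 ≠ 0 := by linarith
    rw [mul_sub ((sylAux d : ℝ) - 1), mul_one_div_cancel h5, one_div, inv_mul_lt_iff₀ hQ]
    linarith
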